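/- arXiv:1710.06534 — 2 statements merged into one kernel-verified Lean document; each statement's English description precedes it below -/
import Mathlib

section
/- Let M be a finite-dimensional complex vector space equipped with a nondegenerate Hermitian form B of signature κ, and let A ⊆ End(M) be a commutative subalgebra over ℝ all of whose elements are B-self-adjoint. Let R = ⋂_{T ∈ A} ⊕_{α ∈ ℝ} M_T(α) be the intersection over all T ∈ A of the sum of the generalized eigenspaces of T with real eigenvalues. Then the restriction of B to R is nondegenerate and has signature κ; in particular dim_ℂ R ≥ |κ|. -/
open Module

/-- A Hermitian-type form `B` on a finite-dimensional complex vector space `M` has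
signature `κ` if there is a `B`-orthogonal basis whose diagonal values lie in
`{1, -1, 0}` and the number of `1`'s minus the number of `-1`'s equals `κ`
(equivalently, the sum of the (real) diagonal values equals `κ`). -/
def HasSignature {M : Type*} [AddCommGroup M] [Module ℂ M] [FiniteDimensional ℂ M]
    (B : M → M → ℂ) (κ : ℤ) : Prop :=
  ∃ e : Basis (Fin (finrank ℂ M)) ℂ M,
    (∀ i j, i ≠ j → B (e i) (e j) = 0) ∧
    (∀ i, B (e i) (e i) = 1 ∨ B (e i) (e i) = -1 ∨ B (e i) (e i) = 0) ∧
    (κ : ℝ) = ∑ i, (B (e i) (e i)).re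

section HermitianForm

variable {M : Type*} [AddCommGroup M] [Module ℂ M]

theorem form_sum_eq (B : M →ₛₗ[starRingEnd ℂ] M →ₗ[ℂ] ℂ) {ι : Type*} [Fintype ι]
    (b : ι → M) (x y : ι → ℂ) :
    B (∑ i, x i • b i) (∑ j, y j • b j) =
      ∑ i, ∑ j, starRingEnd ℂ (x i) * (y j * B (b i) (b j)) := by
  simp only [map_sum, LinearMap.sum_apply, LinearMap.map_smulₛₗ, LinearMap.smul_apply, smul_eq_mul,
    RingHom.id_apply, Finset.mul_sum]
  rw [Finset.sum_comm]
  exact Finset.sum_congr rfl fun i _ => Finset.sum_congr rfl fun j _ => by ring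

theorem form_sum_self_of_orthogonal (B : M →ₛₗ[starRingEnd ℂ] M →ₗ[ℂ] ℂ) {ι : Type*} [Fintype ι]
    (b : ι → M) (hb : ∀ i j, i ≠ j → B (b i) (b j) = 0) (x : ι → ℂ) :
    (B (∑ i, x i • b i) (∑ j, x j • b j)).re =
      ∑ i, Complex.normSq (x i) * (B (b i) (b i)).re := by
  rw [form_sum_eq, Complex.re_sum]
  refine Finset.sum_congr rfl fun i _ => ?_
  rw [Finset.sum_eq_single i (fun j _ hj => by rw [hb i j hj.symm]; simp) (by simp),
    ← mul_assoc, mul_comm (starRingEnd ℂ (x i)), Complex.mul_conj, Complex.re_ofReal_mul]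

/-- The span of those vectors of an orthogonal basis on which `s • B` takes the value `1`
is a positive definite subspace for `s • B`. -/
theorem exists_definite_submodule (B : M →ₛₗ[starRingEnd ℂ] M →ₗ[ℂ] ℂ) {ι : Type*} [Fintype ι]
    (e : Basis ι ℂ M) (he : ∀ i j, i ≠ j → B (e i) (e j) = 0) (s : ℝ) (P : ι → Prop)
    [DecidablePred P] (hP : ∀ i, P i → 0 < s * (B (e i) (e i)).re) :
    ∃ W : Submodule ℂ M, finrank ℂ W = (Finset.univ.filter P).card ∧
      ∀ v ∈ W, v ≠ 0 → 0 < s * (B v v).re := by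
  have hli : LinearIndependent ℂ (fun i : {i // P i} => e i) :=
    e.linearIndependent.comp _ Subtype.val_injective
  refine ⟨Submodule.span ℂ (Set.range fun i : {i // P i} => e i), ?_, ?_⟩
  · rw [finrank_span_eq_card hli, Fintype.card_subtype]
  · intro v hv hv0
    obtain ⟨c, rfl⟩ := (Submodule.mem_span_range_iff_exists_fun ℂ).1 hv
    rw [form_sum_self_of_orthogonal B (fun i : {i // P i} => e i)
      (fun i j hij => he i j (by simpa [Subtype.ext_iff] using hij)), Finset.mul_sum]
    have hterm : ∀ i : {i // P i}, 0 ≤ s * (Complex.normSq (c i) * (B (e i) (e i)).re) :=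
      fun i => by
        have := mul_nonneg (Complex.normSq_nonneg (c i)) (hP i i.2).le
        linarith
    refine lt_of_le_of_ne (Finset.sum_nonneg fun i _ => hterm i) fun h => hv0 ?_
    have h0 := (Finset.sum_eq_zero_iff_of_nonneg fun i _ => hterm i).1 h.symm
    refine Finset.sum_eq_zero fun i hi => ?_
    have h1 : Complex.normSq (c i) * (s * (B (e i) (e i)).re) = 0 := by linarith [h0 i hi]
    rw [Complex.normSq_eq_zero.1 ((mul_eq_zero.1 h1).resolve_right (hP i i.2).ne'), zero_smul]

/-- Generalized eigenspaces of a self-adjoint operator are orthogonal unless their eigenvalues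
are complex conjugate. -/
theorem form_eq_zero_of_mem_genEigenspace (B : M →ₛₗ[starRingEnd ℂ] M →ₗ[ℂ] ℂ)
    (T : Module.End ℂ M) (hT : ∀ v w : M, B (T v) w = B v (T w)) {α β : ℂ}
    (hαβ : starRingEnd ℂ α ≠ β) {v w : M} (hv : v ∈ T.maxGenEigenspace α)
    (hw : w ∈ T.maxGenEigenspace β) : B v w = 0 := by
  obtain ⟨k, hk⟩ := (Module.End.mem_maxGenEigenspace _ _ _).1 hv
  obtain ⟨l, hl⟩ := (Module.End.mem_maxGenEigenspace _ _ _).1 hw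
  have hadj : ∀ (m : ℕ) (x y : M), B (((T - α • (1 : Module.End ℂ M)) ^ m) x) y =
      B x (((T - starRingEnd ℂ α • (1 : Module.End ℂ M)) ^ m) y) := by
    intro m
    induction m with
    | zero => simp
    | succ m ih =>
      intro x y
      rw [pow_succ, pow_succ', Module.End.mul_apply, ih]
      simp [hT]
  have hcop : IsCoprime
      ((Polynomial.X - Polynomial.C (starRingEnd ℂ α)) ^ k) ((Polynomial.X - Polynomial.C β) ^ l) :=
    (Polynomial.isCoprime_X_sub_C_of_isUnit_sub (sub_ne_zero.2 hαβ).isUnit).pow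
  obtain ⟨p, q, hpq⟩ := hcop
  rw [mul_comm p] at hpq
  have h := congrArg (fun r => Polynomial.aeval T r w) hpq
  simp only [map_add, map_mul, map_pow, map_sub, Polynomial.aeval_X, Polynomial.aeval_C, map_one,
    Algebra.algebraMap_eq_smul_one, LinearMap.add_apply, Module.End.mul_apply, hl, map_zero,
    add_zero, Module.End.one_apply] at h
  rw [← h, ← hadj, hk, map_zero, LinearMap.zero_apply]

variable [FiniteDimensional ℂ M]

/-- A nondegenerate form of signature `κ` admits a positive definite and a negative definite
subspace whose dimensions add up to `dim M` and differ by `κ`. -/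
theorem HasSignature.exists_definite_submodules {B : M →ₛₗ[starRingEnd ℂ] M →ₗ[ℂ] ℂ}
    (hNondeg : ∀ v : M, (∀ w : M, B v w = 0) → v = 0)
    {κ : ℤ} (hSig : HasSignature (fun v w => B v w) κ) :
    ∃ W₁ W₂ : Submodule ℂ M, (∀ v ∈ W₁, v ≠ 0 → 0 < (B v v).re) ∧
      (∀ v ∈ W₂, v ≠ 0 → (B v v).re < 0) ∧
      finrank ℂ W₁ + finrank ℂ W₂ = finrank ℂ M ∧
      (finrank ℂ W₁ : ℤ) - finrank ℂ W₂ = κ := by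
  classical
  obtain ⟨e, he, hval, hκ⟩ := hSig
  dsimp only at he hval hκ
  have hne : ∀ i, B (e i) (e i) ≠ 0 := fun i hi => e.ne_zero i <| hNondeg _ fun w => by
    have : B (e i) = 0 := e.ext fun j => by
      by_cases hij : i = j
      · subst hij; simpa using hi
      · simpa using he i j hij
    simp [this]
  have hval' : ∀ i, B (e i) (e i) = if B (e i) (e i) = 1 then 1 else -1 := fun i => by
    rcases hval i with h | h | h
    · simp [h]
    · rw [h]; norm_num
    · exact absurd h (hne i)
  obtain ⟨W₁, hd₁, hW₁⟩ := exists_definite_submodule B e he 1 (fun i => B (e i) (e i) = 1)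
    (fun i hi => by simp [hi])
  obtain ⟨W₂, hd₂, hW₂⟩ := exists_definite_submodule B e he (-1) (fun i => ¬ B (e i) (e i) = 1)
    (fun i hi => by rw [hval' i, if_neg hi]; simp)
  refine ⟨W₁, W₂, fun v hv h0 => by simpa using hW₁ v hv h0,
    fun v hv h0 => by simpa using hW₂ v hv h0, ?_, ?_⟩
  · rw [hd₁, hd₂, Finset.card_filter_add_card_filter_not]; simp
  · have hre : ∀ i, (B (e i) (e i)).re = if B (e i) (e i) = 1 then (1 : ℝ) else -1 := fun i => by
      conv_lhs => rw [hval' i]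
      split_ifs <;> simp
    rw [Finset.sum_congr rfl fun i _ => hre i, Finset.sum_ite] at hκ
    rw [hd₁, hd₂]
    simp only [Finset.sum_const, nsmul_eq_mul, mul_one, mul_neg] at hκ
    have : (κ : ℝ) = (((Finset.univ.filter fun i => B (e i) (e i) = 1).card : ℤ) -
      ((Finset.univ.filter fun i => ¬ B (e i) (e i) = 1).card : ℤ) : ℤ) := by
      push_cast; linarith
    exact (Int.cast_injective this).symm

/-- A Hermitian form has an orthogonal basis. -/
theorem exists_orthogonal_basis_of_hermitian (B : M →ₛₗ[starRingEnd ℂ] M →ₗ[ℂ] ℂ)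
    (hHerm : ∀ v w : M, B w v = starRingEnd ℂ (B v w)) :
    ∃ e : Basis (Fin (finrank ℂ M)) ℂ M, ∀ i j, i ≠ j → B (e i) (e j) = 0 := by
  let b := finBasis ℂ M
  let H : Matrix (Fin (finrank ℂ M)) (Fin (finrank ℂ M)) ℂ := Matrix.of fun i j => B (b i) (b j)
  have hH : H.IsHermitian := by
    ext i j
    simp [H, Matrix.conjTranspose_apply, hHerm (b i) (b j)]
  let Φ : EuclideanSpace ℂ (Fin (finrank ℂ M)) ≃ₗ[ℂ] M :=
    (WithLp.linearEquiv 2 ℂ _).trans b.equivFun.symm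
  have hΦ : ∀ x, Φ x = ∑ i, x i • b i := fun x => by
    simp [Φ, Basis.equivFun_symm_apply]
  refine ⟨hH.eigenvectorBasis.toBasis.map Φ, fun i j hij => ?_⟩
  have key : ∀ x y : EuclideanSpace ℂ (Fin (finrank ℂ M)),
      B (Φ x) (Φ y) = inner ℂ x (WithLp.toLp 2 (H.mulVec y)) := fun x y => by
    rw [hΦ, hΦ, form_sum_eq, PiLp.inner_apply]
    refine Finset.sum_congr rfl fun i _ => ?_
    simp only [Matrix.mulVec, dotProduct, H, Matrix.of_apply, RCLike.inner_apply, Finset.sum_mul]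
    exact Finset.sum_congr rfl fun j _ => by ring
  simp only [Basis.map_apply, OrthonormalBasis.coe_toBasis]
  rw [key, hH.mulVec_eigenvectorBasis]
  have : WithLp.toLp 2 (hH.eigenvalues j • (hH.eigenvectorBasis j : Fin (finrank ℂ M) → ℂ)) =
      (hH.eigenvalues j : ℂ) • hH.eigenvectorBasis j := by
    ext; simp
  rw [this, inner_smul_right, hH.eigenvectorBasis.orthonormal.2 hij, mul_zero]

theorem exists_hasSignature (B : M →ₛₗ[starRingEnd ℂ] M →ₗ[ℂ] ℂ)
    (hHerm : ∀ v w : M, B w v = starRingEnd ℂ (B v w)) :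
    ∃ κ : ℤ, HasSignature (fun v w => B v w) κ := by
  obtain ⟨e, he⟩ := exists_orthogonal_basis_of_hermitian B hHerm
  have hreal : ∀ v, B v v = ((B v v).re : ℂ) := fun v =>
    (Complex.conj_eq_iff_re.1 (hHerm v v).symm).symm
  have hscale : ∀ i, ∃ c : ℂˣ, B ((c : ℂ) • e i) ((c : ℂ) • e i) =
      (SignType.sign (B (e i) (e i)).re : ℝ) := fun i => by
    generalize hr : (B (e i) (e i)).re = r
    have hB : B (e i) (e i) = r := by rw [hreal, hr]
    by_cases h0 : r = 0
    · exact ⟨1, by simp [hB, h0]⟩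
    · have hs : Real.sqrt |r| ≠ 0 := by positivity
      refine ⟨Units.mk0 (((Real.sqrt |r|)⁻¹ : ℝ) : ℂ) (by simpa using hs), ?_⟩
      simp only [Units.val_mk0, LinearMap.map_smulₛₗ, LinearMap.smul_apply, hB, Complex.conj_ofReal,
        map_smul, smul_eq_mul, ← Complex.ofReal_mul]
      congr 1
      have h2 := Real.mul_self_sqrt (abs_nonneg r)
      field_simp
      rw [sq, h2, mul_comm, sign_mul_abs]
  choose c hc using hscale
  have hval : ∀ i, B (e.unitsSMul c i) (e.unitsSMul c i) =
      (SignType.sign (B (e i) (e i)).re : ℝ) := fun i => by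
    rw [Basis.unitsSMul_apply]; exact hc i
  refine ⟨∑ i, (SignType.sign (B (e i) (e i)).re : ℤ), e.unitsSMul c, fun i j hij => ?_,
    fun i => ?_, ?_⟩
  · simp [Basis.unitsSMul_apply, Units.smul_def, he i j hij]
  · dsimp only
    rw [hval]
    rcases SignType.trichotomy (SignType.sign (B (e i) (e i)).re) with h | h | h <;> simp [h]
  · push_cast
    refine Finset.sum_congr rfl fun i _ => ?_
    rw [hval, Complex.ofReal_re]

/-- A semidefinite subspace built from a definite subspace and an isotropic one is disjoint from
every subspace of opposite sign, which bounds the dimensions. -/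
theorem finrank_add_add_le (B : M →ₛₗ[starRingEnd ℂ] M →ₗ[ℂ] ℂ) (s : ℝ) {V P N : Submodule ℂ M}
    (hV : ∀ v ∈ V, v ≠ 0 → 0 < s * (B v v).re) (hP : ∀ v ∈ P, B v v = 0)
    (hVP : ∀ v ∈ V, ∀ w ∈ P, B v w = 0) (hPV : ∀ v ∈ V, ∀ w ∈ P, B w v = 0)
    (hN : ∀ v ∈ N, v ≠ 0 → s * (B v v).re < 0) :
    finrank ℂ V + finrank ℂ P + finrank ℂ N ≤ finrank ℂ M := by
  have h1 : Disjoint V P := Submodule.disjoint_def.2 fun v hv hp => by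
    by_contra h0
    simpa [hP v hp] using hV v hv h0
  have h2 : Disjoint (V ⊔ P) N := Submodule.disjoint_def.2 fun v hv hn => by
    by_contra h0
    have hneg := hN v hn h0
    obtain ⟨x, hx, y, hy, rfl⟩ := Submodule.mem_sup.1 hv
    have hxx : 0 ≤ s * (B x x).re := by
      by_cases hx0 : x = 0
      · simp [hx0]
      · exact (hV x hx hx0).le
    simp only [map_add, LinearMap.add_apply, hVP x hx y hy, hPV x hx y hy, hP y hy, add_zero] at hneg
    linarith
  have h3 := Submodule.finrank_sup_add_finrank_inf_eq V P
  rw [h1.eq_bot, finrank_bot] at h3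
  have h4 := Submodule.finrank_add_finrank_le_of_disjoint h2
  omega

/-- If `M` is spanned by `R` together with two isotropic subspaces orthogonal to `R`, then `B`
restricts to a nondegenerate form of the same signature on `R`. -/
theorem signature_of_orthogonal_isotropic (B : M →ₛₗ[starRingEnd ℂ] M →ₗ[ℂ] ℂ)
    (hHerm : ∀ v w : M, B w v = starRingEnd ℂ (B v w))
    (hNondeg : ∀ v : M, (∀ w : M, B v w = 0) → v = 0)
    {κ : ℤ} (hSig : HasSignature (fun v w => B v w) κ) {R P Q : Submodule ℂ M}
    (hP : ∀ v ∈ P, ∀ w ∈ P, B v w = 0) (hQ : ∀ v ∈ Q, ∀ w ∈ Q, B v w = 0)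
    (hRP : ∀ v ∈ R, ∀ w ∈ P, B v w = 0) (hRQ : ∀ v ∈ R, ∀ w ∈ Q, B v w = 0)
    (htop : R ⊔ (P ⊔ Q) = ⊤) :
    (∀ v ∈ R, (∀ w ∈ R, B v w = 0) → v = 0) ∧
    HasSignature (fun v w : R => B v w) κ ∧
    |κ| ≤ (finrank ℂ R : ℤ) := by
  have hnd : ∀ v ∈ R, (∀ w ∈ R, B v w = 0) → v = 0 := fun v hv h => hNondeg v fun w => by
    have hle : R ⊔ (P ⊔ Q) ≤ LinearMap.ker (B v) :=
      sup_le (fun w hw => h w hw) (sup_le (fun w hw => hRP v hv w hw) fun w hw => hRQ v hv w hw)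
    exact hle (htop ▸ Submodule.mem_top)
  have hPR : ∀ v ∈ R, ∀ w ∈ P, B w v = 0 := fun v hv w hw => by
    rw [hHerm v w, hRP v hv w hw, map_zero]
  have hQR : ∀ v ∈ R, ∀ w ∈ Q, B w v = 0 := fun v hv w hw => by
    rw [hHerm v w, hRQ v hv w hw, map_zero]
  let BR := B.domRestrict₁₂ R R
  obtain ⟨κ', hκ'⟩ := exists_hasSignature BR fun v w => hHerm v w
  obtain ⟨U₁, U₂, hU₁, hU₂, hUadd, hUsub⟩ := hκ'.exists_definite_submodules
    (fun v h => Subtype.ext (hnd v v.2 fun w hw => h ⟨w, hw⟩))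
  obtain ⟨W₁, W₂, hW₁, hW₂, hWadd, hWsub⟩ := hSig.exists_definite_submodules hNondeg
  have hpos : ∀ v ∈ U₁.map R.subtype, v ≠ 0 → 0 < 1 * (B v v).re := by
    rintro _ ⟨v, hv, rfl⟩ h0
    rw [one_mul]
    exact hU₁ v hv (by rintro rfl; exact h0 rfl)
  have hneg : ∀ v ∈ U₂.map R.subtype, v ≠ 0 → 0 < (-1) * (B v v).re := by
    rintro _ ⟨v, hv, rfl⟩ h0
    rw [neg_one_mul, neg_pos]
    exact hU₂ v hv (by rintro rfl; exact h0 rfl)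
  have hle₁ : U₁.map R.subtype ≤ R := Submodule.map_subtype_le R U₁
  have hle₂ : U₂.map R.subtype ≤ R := Submodule.map_subtype_le R U₂
  have hW₁' : ∀ v ∈ W₁, v ≠ 0 → (-1) * (B v v).re < 0 := fun v hv h0 => by
    simpa using hW₁ v hv h0
  have hW₂' : ∀ v ∈ W₂, v ≠ 0 → 1 * (B v v).re < 0 := fun v hv h0 => by
    simpa using hW₂ v hv h0
  have i₁ := finrank_add_add_le B 1 hpos (fun v hv => hP v hv v hv)
    (fun v hv => hRP v (hle₁ hv)) (fun v hv => hPR v (hle₁ hv)) hW₂'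
  have i₂ := finrank_add_add_le B 1 hpos (fun v hv => hQ v hv v hv)
    (fun v hv => hRQ v (hle₁ hv)) (fun v hv => hQR v (hle₁ hv)) hW₂'
  have i₃ := finrank_add_add_le B (-1) hneg (fun v hv => hP v hv v hv)
    (fun v hv => hRP v (hle₂ hv)) (fun v hv => hPR v (hle₂ hv)) hW₁'
  have i₄ := finrank_add_add_le B (-1) hneg (fun v hv => hQ v hv v hv)
    (fun v hv => hRQ v (hle₂ hv)) (fun v hv => hQR v (hle₂ hv)) hW₁'
  rw [Submodule.finrank_map_subtype_eq] at i₁ i₂ i₃ i₄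
  have hdim : finrank ℂ M ≤ finrank ℂ R + (finrank ℂ P + finrank ℂ Q) := by
    rw [← finrank_top ℂ M, ← htop]
    exact (Submodule.finrank_add_le_finrank_add_finrank _ _).trans
      (Nat.add_le_add_left (Submodule.finrank_add_le_finrank_add_finrank _ _) _)
  have hκκ' : κ = κ' := by omega
  refine ⟨hnd, hκκ' ▸ hκ', ?_⟩
  rw [abs_le]
  omega

end HermitianForm

/-- Let `M` be a finite-dimensional complex vector space with a nondegenerate Hermitian
form `B` of signature `κ`, and let `A ⊆ End(M)` be a commutative subalgebra over `ℝ`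
whose elements are `B`-self-adjoint.  Let `R = ⋂_{T ∈ A} ⊕_{α ∈ ℝ} M_T(α)`.  Then the
restriction of `B` to `R` is nondegenerate of signature `κ`; in particular
`dim_ℂ R ≥ |κ|`. -/
theorem stmt0 {M : Type*} [AddCommGroup M] [Module ℂ M] [FiniteDimensional ℂ M]
    (B : M →ₛₗ[starRingEnd ℂ] M →ₗ[ℂ] ℂ)
    (hHerm : ∀ v w : M, B w v = starRingEnd ℂ (B v w))
    (hNondeg : ∀ v : M, (∀ w : M, B v w = 0) → v = 0)
    (κ : ℤ) (hSig : HasSignature (fun v w => B v w) κ)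
    (A : Subalgebra ℝ (Module.End ℂ M))
    (hComm : ∀ T ∈ A, ∀ S ∈ A, T * S = S * T)
    (hSA : ∀ T ∈ A, ∀ v w : M, B (T v) w = B v (T w))
    (R : Submodule ℂ M)
    (hR : R = ⨅ T ∈ A, ⨆ α : ℝ,
        LinearMap.ker ((T - (α : ℂ) • (1 : Module.End ℂ M)) ^ finrank ℂ M)) :
    (∀ v ∈ R, (∀ w ∈ R, B v w = 0) → v = 0) ∧
    HasSignature (fun v w : R => B v w) κ ∧
    |κ| ≤ (finrank ℂ R : ℤ) := by
  classical
  let E : (A → ℂ) → Submodule ℂ M := fun χ => ⨅ T : A, (T : Module.End ℂ M).maxGenEigenspace (χ T)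
  let cj : (A → ℂ) → A → ℂ := fun χ T => starRingEnd ℂ (χ T)
  have hcj : ∀ χ, cj (cj χ) = χ := fun χ => funext fun T => Complex.conj_conj _
  have hmax : ∀ (T : Module.End ℂ M) (α : ℂ),
      LinearMap.ker ((T - α • (1 : Module.End ℂ M)) ^ finrank ℂ M) = T.maxGenEigenspace α :=
    fun T α => by
      rw [Module.End.maxGenEigenspace_eq_genEigenspace_finrank, Module.End.genEigenspace_nat]
  simp only [hmax] at hR
  have hspan : ⨆ χ, E χ = ⊤ :=
    Module.End.iSup_iInf_maxGenEigenspace_eq_top_of_iSup_maxGenEigenspace_eq_top_of_commute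
      (fun T : A => (T : Module.End ℂ M)) (fun T S _ => hComm T T.2 S S.2)
      (fun T => Module.End.iSup_maxGenEigenspace_eq_top _)
  have horth : ∀ χ ψ, cj χ ≠ ψ → ∀ v ∈ E χ, ∀ w ∈ E ψ, B v w = 0 := fun χ ψ h v hv w hw => by
    obtain ⟨T, hT⟩ := Function.ne_iff.1 h
    exact form_eq_zero_of_mem_genEigenspace B T (hSA T T.2) hT
      ((Submodule.mem_iInf _).1 hv T) ((Submodule.mem_iInf _).1 hw T)
  have hRorth : ∀ χ, cj χ ≠ χ → ∀ v ∈ R, ∀ w ∈ E χ, B v w = 0 := fun χ h v hv w hw => by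
    obtain ⟨T, hT⟩ := Function.ne_iff.1 h
    rw [hR] at hv
    have hv' := (Submodule.mem_iInf _).1 ((Submodule.mem_iInf _).1 hv T.1) T.2
    refine Submodule.iSup_induction _ (motive := fun v => B v w = 0) hv' (fun α x hx => ?_)
      (by simp) (fun x y hx hy => by simp [hx, hy])
    refine form_eq_zero_of_mem_genEigenspace B T (hSA T T.2) (fun h' => hT ?_) hx
      ((Submodule.mem_iInf _).1 hw T)
    simp [cj, ← h']
  have hreal : ∀ χ, cj χ = χ → E χ ≤ R := fun χ h => by
    rw [hR]
    refine le_iInf₂ fun T hT => ?_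
    have hχ : (((χ ⟨T, hT⟩).re : ℝ) : ℂ) = χ ⟨T, hT⟩ :=
      Complex.conj_eq_iff_re.1 (congrFun h ⟨T, hT⟩)
    refine le_trans ?_ (le_iSup _ (χ ⟨T, hT⟩).re)
    rw [hχ]
    exact iInf_le (fun T : A => (T : Module.End ℂ M).maxGenEigenspace (χ T)) ⟨T, hT⟩
  -- An arbitrary linear order on characters selects one member of each conjugate pair.
  let _ : LinearOrder (A → ℂ) := linearOrderOfSTO WellOrderingRel
  have hiso : ∀ U : Set (A → ℂ), (∀ χ ∈ U, ∀ ψ ∈ U, cj χ ≠ ψ) →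
      ∀ v ∈ ⨆ χ ∈ U, E χ, ∀ w ∈ ⨆ χ ∈ U, E χ, B v w = 0 := fun U hU v hv w hw => by
    have h1 : ∀ χ ∈ U, ∀ v ∈ E χ, ⨆ ψ ∈ U, E ψ ≤ LinearMap.ker (B v) := fun χ hχ v hv =>
      iSup₂_le fun ψ hψ x hx => horth χ ψ (hU χ hχ ψ hψ) v hv x hx
    have h2 : ⨆ χ ∈ U, E χ ≤ LinearMap.ker (B.flip w) :=
      iSup₂_le fun χ hχ x hx => h1 χ hχ x hx hw
    exact h2 hv
  have hRiso : ∀ U : Set (A → ℂ), (∀ χ ∈ U, cj χ ≠ χ) →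
      ∀ v ∈ R, ∀ w ∈ ⨆ χ ∈ U, E χ, B v w = 0 := fun U hU v hv w hw => by
    have h1 : ⨆ χ ∈ U, E χ ≤ LinearMap.ker (B v) :=
      iSup₂_le fun χ hχ x hx => hRorth χ (hU χ hχ) v hv x hx
    exact h1 hw
  refine signature_of_orthogonal_isotropic B hHerm hNondeg hSig
    (hiso {χ | χ < cj χ} ?_) (hiso {χ | cj χ < χ} ?_)
    (hRiso {χ | χ < cj χ} fun χ h => ne_of_gt h) (hRiso {χ | cj χ < χ} fun χ h => ne_of_lt h) ?_
  · rintro χ hχ _ hψ rfl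
    simp only [Set.mem_ofPred_eq, hcj] at hχ hψ
    exact lt_asymm hχ hψ
  · rintro χ hχ _ hψ rfl
    simp only [Set.mem_ofPred_eq, hcj] at hχ hψ
    exact lt_asymm hχ hψ
  · rw [eq_top_iff, ← hspan]
    refine iSup_le fun χ => ?_
    rcases lt_trichotomy χ (cj χ) with h | h | h
    · exact (le_iSup₂_of_le (f := fun χ (_ : χ ∈ {χ | χ < cj χ}) => E χ) χ h le_rfl).trans
        (le_sup_left.trans le_sup_right)
    · exact (hreal χ h.symm).trans le_sup_left
    · exact (le_iSup₂_of_le (f := fun χ (_ : χ ∈ {χ | cj χ < χ}) => E χ) χ h le_rfl).trans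
        (le_sup_right.trans le_sup_right)
end

section
/- Let M be a finite-dimensional complex vector space with a Hermitian form B, and let T ∈ End(M) be B-self-adjoint. If α, β ∈ ℂ satisfy β ≠ conj(α), then the generalized eigenspaces M_T(α) and M_T(β) are B-orthogonal, i.e., B(v,w) = 0 for all v ∈ M_T(α) and w ∈ M_T(β). -/
open Module

/-- Vectors killed by powers of `T - α` and `T - β` are orthogonal for any sesquilinear form
for which `T` is self-adjoint, provided `β ≠ conj α`. -/
theorem sesqForm_eq_zero_of_pow_sub_smul_apply_eq_zero {M : Type*} [AddCommGroup M] [Module ℂ M]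
    (B : M →ₛₗ[starRingEnd ℂ] M →ₗ[ℂ] ℂ) (T : Module.End ℂ M)
    (hSA : ∀ v w : M, B (T v) w = B v (T w))
    {α β : ℂ} (hαβ : β ≠ starRingEnd ℂ α) (m n : ℕ) (v w : M)
    (hv : ((T - α • (1 : Module.End ℂ M)) ^ m) v = 0)
    (hw : ((T - β • (1 : Module.End ℂ M)) ^ n) w = 0) :
    B v w = 0 := by
  induction m generalizing v w n with
  | zero => simp_all
  | succ m ihm =>
    induction n generalizing w with
    | zero => simp_all
    | succ n ihn =>
      have h₁ := ihm (n + 1) ((T - α • (1 : Module.End ℂ M)) v) w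
        (by rwa [pow_succ, Module.End.mul_apply] at hv) hw
      have h₂ := ihn ((T - β • (1 : Module.End ℂ M)) w)
        (by rwa [pow_succ, Module.End.mul_apply] at hw)
      simp only [LinearMap.sub_apply, LinearMap.smul_apply, Module.End.one_apply, map_sub,
        map_smulₛₗ, RingHom.id_apply, smul_eq_mul, hSA] at h₁ h₂
      have h : (β - starRingEnd ℂ α) * B v w = 0 := by linear_combination h₁ - h₂
      exact (mul_eq_zero.mp h).resolve_left (sub_ne_zero.mpr hαβ)

/-- Let `M` be a finite-dimensional complex vector space with a Hermitian form `B`, and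
let `T ∈ End(M)` be `B`-self-adjoint.  If `β ≠ conj α`, then the generalized eigenspaces
`M_T(α) = ker((T - α)^{dim M})` and `M_T(β)` are `B`-orthogonal. -/
theorem stmt1 {M : Type*} [AddCommGroup M] [Module ℂ M] [FiniteDimensional ℂ M]
    (B : M →ₛₗ[starRingEnd ℂ] M →ₗ[ℂ] ℂ)
    (hHerm : ∀ v w : M, B w v = starRingEnd ℂ (B v w))
    (T : Module.End ℂ M)
    (hSA : ∀ v w : M, B (T v) w = B v (T w))
    (α β : ℂ) (hαβ : β ≠ starRingEnd ℂ α)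
    (v w : M)
    (hv : v ∈ LinearMap.ker ((T - α • (1 : Module.End ℂ M)) ^ finrank ℂ M))
    (hw : w ∈ LinearMap.ker ((T - β • (1 : Module.End ℂ M)) ^ finrank ℂ M)) :
    B v w = 0 := by
  exact sesqForm_eq_zero_of_pow_sub_smul_apply_eq_zero B T hSA hαβ _ _ v w
    (LinearMap.mem_ker.mp hv) (LinearMap.mem_ker.mp hw)
end
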